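/- (1) If 0 → C → D → Q → 0 is an exact sequence in ∗Cat^nu_ℂ, then 0 → A^alg(C) → A^alg(D) → A^alg(Q) → 0 is an exact sequence of ∗-algebras over ℂ. (2) If 0 → C → D → Q → 0 is an exact sequence of C*-categories, then 0 → A(C) → A(D) → A(Q) → 0 is an exact sequence of C*-algebras. -/

import Mathlib

noncomputable section

open scoped ENNReal

/-- A possibly non-unital ℂ-linear ∗-category. -/
structure StarCatNu : Type 1 where
  Obj : Type
  Hom : Obj → Obj → Type
  [homAddCommGroup : ∀ X Y, AddCommGroup (Hom X Y)]
  [homModule : ∀ X Y, Module ℂ (Hom X Y)]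
  comp : ∀ {X Y Z : Obj}, Hom Y Z → Hom X Y → Hom X Z
  star : ∀ {X Y : Obj}, Hom X Y → Hom Y X
  comp_assoc : ∀ {W X Y Z : Obj} (h : Hom Y Z) (g : Hom X Y) (f : Hom W X),
    comp (comp h g) f = comp h (comp g f)
  add_comp : ∀ {X Y Z : Obj} (g g' : Hom Y Z) (f : Hom X Y),
    comp (g + g') f = comp g f + comp g' f
  comp_add : ∀ {X Y Z : Obj} (g : Hom Y Z) (f f' : Hom X Y),
    comp g (f + f') = comp g f + comp g f'
  smul_comp : ∀ {X Y Z : Obj} (c : ℂ) (g : Hom Y Z) (f : Hom X Y),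
    comp (c • g) f = c • comp g f
  comp_smul : ∀ {X Y Z : Obj} (c : ℂ) (g : Hom Y Z) (f : Hom X Y),
    comp g (c • f) = c • comp g f
  star_star : ∀ {X Y : Obj} (f : Hom X Y), star (star f) = f
  star_comp : ∀ {X Y Z : Obj} (g : Hom Y Z) (f : Hom X Y),
    star (comp g f) = comp (star f) (star g)
  star_add : ∀ {X Y : Obj} (f f' : Hom X Y), star (f + f') = star f + star f'
  star_smul : ∀ {X Y : Obj} (c : ℂ) (f : Hom X Y),
    star (c • f) = (starRingEnd ℂ) c • star f

attribute [instance] StarCatNu.homAddCommGroup StarCatNu.homModule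

namespace StarCatNu

/-- Transport of morphisms along equalities of objects. -/
def castHom (C : StarCatNu) {X X' Y Y' : C.Obj} (hX : X = X') (hY : Y = Y')
    (f : C.Hom X Y) : C.Hom X' Y' := hX ▸ hY ▸ f

theorem comp_zero (C : StarCatNu) {X Y Z : C.Obj} (g : C.Hom Y Z) :
    C.comp g (0 : C.Hom X Y) = 0 :=
  (AddMonoidHom.mk' (fun f : C.Hom X Y => C.comp g f) (C.comp_add g)).map_zero

theorem zero_comp (C : StarCatNu) {X Y Z : C.Obj} (f : C.Hom X Y) :
    C.comp (0 : C.Hom Y Z) f = 0 :=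
  (AddMonoidHom.mk' (fun g : C.Hom Y Z => C.comp g f) (fun a b => C.add_comp a b f)).map_zero

theorem star_zero' (C : StarCatNu) {X Y : C.Obj} :
    C.star (0 : C.Hom X Y) = 0 :=
  (AddMonoidHom.mk' (fun f : C.Hom X Y => C.star f) C.star_add).map_zero

end StarCatNu

/-- A (not necessarily unit-preserving) functor between possibly non-unital ℂ-linear
∗-categories, compatible with the enrichment and the involutions. -/
structure StarFunctor (C D : StarCatNu) where
  obj : C.Obj → D.Obj
  map : ∀ {X Y : C.Obj}, C.Hom X Y → D.Hom (obj X) (obj Y)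
  map_add : ∀ (X Y : C.Obj) (f f' : C.Hom X Y), map (f + f') = map f + map f'
  map_smul : ∀ (X Y : C.Obj) (c : ℂ) (f : C.Hom X Y), map (c • f) = c • map f
  map_comp : ∀ (X Y Z : C.Obj) (g : C.Hom Y Z) (f : C.Hom X Y),
    map (C.comp g f) = D.comp (map g) (map f)
  map_star : ∀ (X Y : C.Obj) (f : C.Hom X Y), map (C.star f) = D.star (map f)

namespace StarFunctor

theorem map_zero {C D : StarCatNu} (F : StarFunctor C D) (X Y : C.Obj) :
    F.map (0 : C.Hom X Y) = 0 :=
  (AddMonoidHom.mk' (fun f : C.Hom X Y => F.map f) (F.map_add X Y)).map_zero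

/-- The identity functor. -/
def id (C : StarCatNu) : StarFunctor C C where
  obj X := X
  map f := f
  map_add _ _ _ _ := rfl
  map_smul _ _ _ _ := rfl
  map_comp _ _ _ _ _ := rfl
  map_star _ _ _ := rfl

/-- Composition of functors: first `F`, then `G`. -/
def comp {C D E : StarCatNu} (F : StarFunctor C D) (G : StarFunctor D E) :
    StarFunctor C E where
  obj X := G.obj (F.obj X)
  map f := G.map (F.map f)
  map_add X Y f f' := by
    show G.map (F.map (f + f')) = G.map (F.map f) + G.map (F.map f')
    rw [F.map_add, G.map_add]
  map_smul X Y c f := by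
    show G.map (F.map (c • f)) = c • G.map (F.map f)
    rw [F.map_smul, G.map_smul]
  map_comp X Y Z g f := by
    show G.map (F.map (C.comp g f)) = E.comp (G.map (F.map g)) (G.map (F.map f))
    rw [F.map_comp, G.map_comp]
  map_star X Y f := by
    show G.map (F.map (C.star f)) = E.star (G.map (F.map f))
    rw [F.map_star, G.map_star]

end StarFunctor

instance : CategoryTheory.Category StarCatNu where
  Hom := StarFunctor
  id := StarFunctor.id
  comp := StarFunctor.comp
  id_comp := by intros; rfl
  comp_id := by intros; rfl
  assoc := by intros; rfl
/-- A possibly non-unital ∗-algebra over ℂ regarded as a ℂ-linear ∗-category with a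
single object. -/
def StarCatNu.ofAlgebra (B : Type) [NonUnitalRing B] [Module ℂ B]
    [SMulCommClass ℂ B B] [IsScalarTower ℂ B B] [StarRing B] [StarModule ℂ B] :
    StarCatNu where
  Obj := PUnit
  Hom _ _ := B
  comp g f := g * f
  star b := Star.star b
  comp_assoc h g f := mul_assoc h g f
  add_comp g g' f := add_mul g g' f
  comp_add g f f' := mul_add g f f'
  smul_comp c g f := smul_mul_assoc c g f
  comp_smul c g f := mul_smul_comm c g f
  star_star f := InvolutiveStar.star_involutive f
  star_comp g f := StarMul.star_mul g f
  star_add f f' := StarAddMonoid.star_add f f'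
  star_smul c f := by
    show Star.star (c • f) = (starRingEnd ℂ) c • Star.star f
    rw [StarModule.star_smul, starRingEnd_apply]

/-- The maximal semi-norm of a morphism in a possibly non-unital ℂ-linear ∗-category:
the supremum of `‖ρ f‖` over all morphisms `ρ` into C*-algebras regarded as one-object
ℂ-linear ∗-categories. -/
noncomputable def StarCatNu.repNorm (C : StarCatNu) {X Y : C.Obj} (f : C.Hom X Y)
    (B : Type) [NonUnitalCStarAlgebra B] (ρ : StarFunctor C (StarCatNu.ofAlgebra B)) : ℝ≥0∞ :=
  (‖id (α := B) (ρ.map f)‖₊ : ℝ≥0∞)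

noncomputable def StarCatNu.maxNorm (C : StarCatNu) {X Y : C.Obj} (f : C.Hom X Y) : ℝ≥0∞ :=
  sSup { r : ℝ≥0∞ | ∃ (B : Type) (i : NonUnitalCStarAlgebra B)
    (ρ : StarFunctor C (StarCatNu.ofAlgebra B)), r = @StarCatNu.repNorm C X Y f B i ρ }

/-- A pre-C*-category: all morphisms have finite maximal semi-norm. -/
def IsPreCStar (C : StarCatNu) : Prop :=
  ∀ (X Y : C.Obj) (f : C.Hom X Y), C.maxNorm f < ⊤

/-- A C*-category: the maximal semi-norm is a finite norm and the morphism spaces are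
complete with respect to it (completeness is expressed via Cauchy sequences). -/
def IsCStar (C : StarCatNu) : Prop :=
  IsPreCStar C ∧
  (∀ (X Y : C.Obj) (f : C.Hom X Y), C.maxNorm f = 0 → f = 0) ∧
  (∀ (X Y : C.Obj) (u : ℕ → C.Hom X Y),
    (∀ ε : ℝ≥0∞, 0 < ε → ∃ N, ∀ m ≥ N, ∀ n ≥ N, C.maxNorm (u m - u n) < ε) →
    ∃ f : C.Hom X Y, ∀ ε : ℝ≥0∞, 0 < ε → ∃ N, ∀ n ≥ N, C.maxNorm (u n - f) < ε)

/-- `e` is an identity morphism at its object. -/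
def IsIdentityAt (C : StarCatNu) {X : C.Obj} (e : C.Hom X X) : Prop :=
  (∀ (Y : C.Obj) (f : C.Hom X Y), C.comp f e = f) ∧
  (∀ (Y : C.Obj) (g : C.Hom Y X), C.comp e g = g)

/-- A ℂ-linear ∗-category is unital if every object admits an identity morphism. -/
def StarCatNu.IsUnital (C : StarCatNu) : Prop :=
  ∀ X : C.Obj, ∃ e : C.Hom X X, IsIdentityAt C e

/-- A functor is unital if it sends identity morphisms to identity morphisms. -/
def StarFunctor.Unital {C D : StarCatNu} (F : StarFunctor C D) : Prop :=
  ∀ (X : C.Obj) (e : C.Hom X X), IsIdentityAt C e → IsIdentityAt D (F.map e)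

/-- A morphism `u` is unitary if `u* ∘ u` and `u ∘ u*` are identity morphisms. -/
def IsUnitary (D : StarCatNu) {A B : D.Obj} (u : D.Hom A B) : Prop :=
  IsIdentityAt D (D.comp (D.star u) u) ∧ IsIdentityAt D (D.comp u (D.star u))

/-- A unitary natural transformation between two functors. -/
structure UnitaryTrans {C D : StarCatNu} (F G : StarFunctor C D) where
  app : ∀ X : C.Obj, D.Hom (F.obj X) (G.obj X)
  natural : ∀ (X Y : C.Obj) (f : C.Hom X Y),
    D.comp (app Y) (F.map f) = D.comp (G.map f) (app X)
  unitary : ∀ X : C.Obj, IsUnitary D (app X)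

/-- A functor is a unitary equivalence if it is invertible up to unitary isomorphism. -/
def IsUnitaryEquiv {C D : StarCatNu} (F : StarFunctor C D) : Prop :=
  ∃ H : StarFunctor D C,
    Nonempty (UnitaryTrans (F.comp H) (StarFunctor.id C)) ∧
    Nonempty (UnitaryTrans (H.comp F) (StarFunctor.id D))

/-- A quotient morphism: bijective on objects and surjective on all morphism spaces. -/
def IsQuotientHom {C D : StarCatNu} (F : StarFunctor C D) : Prop :=
  Function.Bijective F.obj ∧
  ∀ (X Y : C.Obj), Function.Surjective (fun f : C.Hom X Y => F.map f)

/-- An exact sequence `0 → C → D → Q → 0`: `p` is a quotient morphism and `i` is the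
inclusion of its kernel. -/
structure IsExactSeq {C D Q : StarCatNu} (i : StarFunctor C D) (p : StarFunctor D Q) : Prop where
  i_obj_bij : Function.Bijective i.obj
  i_map_inj : ∀ (X Y : C.Obj), Function.Injective (fun f : C.Hom X Y => i.map f)
  p_quot : IsQuotientHom p
  exact : ∀ (X Y : C.Obj) (f : D.Hom (i.obj X) (i.obj Y)),
    p.map f = 0 ↔ ∃ g : C.Hom X Y, i.map g = f

/-- `ι : C → Cc` exhibits the C*-category `Cc` as the completion of the pre-C*-category `C`
with respect to the maximal semi-norm. -/
structure IsCompletion (C Cc : StarCatNu) (ι : StarFunctor C Cc) : Prop where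
  pre : IsPreCStar C
  cstar : IsCStar Cc
  obj_bij : Function.Bijective ι.obj
  isometric : ∀ (X Y : C.Obj) (f : C.Hom X Y), Cc.maxNorm (ι.map f) = C.maxNorm f
  dense : ∀ (X Y : C.Obj) (h : Cc.Hom (ι.obj X) (ι.obj Y)) (ε : ℝ≥0∞), 0 < ε →
    ∃ f : C.Hom X Y, Cc.maxNorm (h - ι.map f) < ε

/-- The maximal semi-norm of an element of a possibly non-unital ∗-algebra over ℂ:
the supremum of `‖φ x‖` over all ∗-homomorphisms `φ` into C*-algebras. -/
noncomputable def algRepNorm (R : Type) [NonUnitalRing R] [Module ℂ R]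
    [SMulCommClass ℂ R R] [IsScalarTower ℂ R R] [StarRing R] [StarModule ℂ R]
    (x : R) (B : Type) [NonUnitalCStarAlgebra B] (φ : R →⋆ₙₐ[ℂ] B) : ℝ≥0∞ :=
  (‖φ x‖₊ : ℝ≥0∞)

/-- The maximal semi-norm on a ∗-algebra over ℂ. -/
noncomputable def algMaxNorm (R : Type) [NonUnitalRing R] [Module ℂ R]
    [SMulCommClass ℂ R R] [IsScalarTower ℂ R R] [StarRing R] [StarModule ℂ R]
    (x : R) : ℝ≥0∞ :=
  sSup { r : ℝ≥0∞ | ∃ (B : Type) (i : NonUnitalCStarAlgebra B) (φ : R →⋆ₙₐ[ℂ] B),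
    r = @algRepNorm R _ _ _ _ _ _ x B i φ }

/-- A ∗-algebra over ℂ is a pre-C*-algebra if all its elements have finite maximal
semi-norm. -/
def IsPreCStarAlg (R : Type) [NonUnitalRing R] [Module ℂ R]
    [SMulCommClass ℂ R R] [IsScalarTower ℂ R R] [StarRing R] [StarModule ℂ R] : Prop :=
  ∀ x : R, algMaxNorm R x < ⊤

/-- `j : R → R̄` exhibits the C*-algebra `R̄` as the completion of the pre-C*-algebra `R`
with respect to the maximal semi-norm. -/
structure IsAlgCompletion (R : Type) [NonUnitalRing R] [Module ℂ R]
    [SMulCommClass ℂ R R] [IsScalarTower ℂ R R] [StarRing R] [StarModule ℂ R]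
    (R' : Type) [NonUnitalCStarAlgebra R'] (j : R →⋆ₙₐ[ℂ] R') : Prop where
  isometric : ∀ x : R, (‖j x‖₊ : ℝ≥0∞) = algMaxNorm R x
  dense : DenseRange j

/-- `A`, together with the family `ι` (sending a morphism `f` to the element `[f]`), is a
realization of the ∗-algebra `A^alg(C)`: the direct sum `⊕_{X,Y ∈ Ob(C)} Hom_C(X, Y)`,
with product `[g][f] = [g ∘ f]` when the morphisms are composable and `0` otherwise, and
involution `[f]* = [f*]`. -/
structure IsAAlg (C : StarCatNu) (A : Type) [NonUnitalRing A] [Module ℂ A]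
    [SMulCommClass ℂ A A] [IsScalarTower ℂ A A] [StarRing A] [StarModule ℂ A] where
  ι : ∀ {X Y : C.Obj}, C.Hom X Y → A
  ι_add : ∀ (X Y : C.Obj) (f f' : C.Hom X Y), ι (f + f') = ι f + ι f'
  ι_smul : ∀ (X Y : C.Obj) (c : ℂ) (f : C.Hom X Y), ι (c • f) = c • ι f
  ι_mul_comp : ∀ (X Y Z : C.Obj) (g : C.Hom Y Z) (f : C.Hom X Y),
    ι g * ι f = ι (C.comp g f)
  ι_mul_ne : ∀ (X Y X' Y' : C.Obj) (g : C.Hom X' Y') (f : C.Hom X Y),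
    Y ≠ X' → ι g * ι f = 0
  ι_star : ∀ (X Y : C.Obj) (f : C.Hom X Y), star (ι f) = ι (C.star f)
  span : ∀ a : A, ∃ (s : Finset (C.Obj × C.Obj)) (φ : ∀ p : C.Obj × C.Obj, C.Hom p.1 p.2),
    a = s.sum fun p => ι (φ p)
  indep : ∀ (s : Finset (C.Obj × C.Obj)) (φ : ∀ p : C.Obj × C.Obj, C.Hom p.1 p.2),
    (s.sum fun p => ι (φ p)) = 0 → ∀ p ∈ s, φ p = 0



theorem hh_cont {A B : Type*} [NonUnitalCStarAlgebra A] [NonUnitalCStarAlgebra B]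
    (φ : A →⋆ₙₐ[ℂ] B) : Continuous φ :=
  AddMonoidHomClass.continuous_of_bound φ 1
    (fun v => by simpa using NonUnitalStarAlgHom.norm_apply_le φ v)

theorem hh_lift_sa {A B : Type*} [NonUnitalCStarAlgebra A] [NonUnitalCStarAlgebra B]
    (φ : A →⋆ₙₐ[ℂ] B) (a : A) (ha : IsSelfAdjoint a) :
    ∃ a' : A, φ a' = φ a ∧ ‖a'‖ ≤ ‖φ a‖ := by
  set r := ‖φ a‖ with hr
  have hr0 : 0 ≤ r := norm_nonneg _
  have hφa : IsSelfAdjoint (φ a) := ha.map φ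
  have h0 : max (-r) (min r 0) = 0 := by
    rw [min_eq_right hr0, max_eq_right (by linarith)]
  refine ⟨cfcₙ (fun t : ℝ => max (-r) (min r t)) a, ?_, ?_⟩
  · rw [NonUnitalStarAlgHom.map_cfcₙ φ (fun t : ℝ => max (-r) (min r t)) a
      (by fun_prop) h0 (hh_cont φ) ha hφa]
    conv_rhs => rw [← cfcₙ_id ℝ (φ a) hφa]
    refine cfcₙ_congr fun t ht => ?_
    have : ‖t‖ ≤ r := by
      have := norm_apply_le_norm_cfcₙ (id : ℝ → ℝ) (φ a) ht continuousOn_id rfl hφa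
      rwa [cfcₙ_id ℝ (φ a) hφa] at this
    rw [Real.norm_eq_abs, abs_le] at this
    simp only [id]
    rw [min_eq_right this.2, max_eq_right this.1]
  · refine norm_cfcₙ_le fun t _ => ?_
    rw [Real.norm_eq_abs, abs_le]
    exact ⟨le_max_left _ _, max_le (by linarith) (min_le_left _ _)⟩

theorem hh_lift {A B : Type*} [NonUnitalCStarAlgebra A] [NonUnitalCStarAlgebra B]
    (φ : A →⋆ₙₐ[ℂ] B) (a : A) :
    ∃ a' : A, φ a' = φ a ∧ ‖a'‖ ≤ 2 * ‖φ a‖ := by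
  obtain ⟨x, hx, hx'⟩ := hh_lift_sa φ (realPart a) (realPart a).2
  obtain ⟨y, hy, hy'⟩ := hh_lift_sa φ (imaginaryPart a) (imaginaryPart a).2
  have e1 : φ (realPart a) = realPart (φ a) := by
    rw [realPart_apply_coe, realPart_apply_coe, map_real_smul φ (hh_cont φ), map_add, map_star]
  have e2 : φ (imaginaryPart a) = imaginaryPart (φ a) := by
    rw [imaginaryPart_apply_coe, imaginaryPart_apply_coe, map_smul, map_real_smul φ (hh_cont φ),
      map_sub, map_star]
  refine ⟨x + Complex.I • y, ?_, ?_⟩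
  · rw [map_add, map_smul, hx, hy, ← map_smul, ← map_add, realPart_add_I_smul_imaginaryPart]
  · rw [e1] at hx'
    rw [e2] at hy'
    have h1 : ‖(realPart (φ a) : B)‖ ≤ ‖φ a‖ := realPart.norm_le (φ a)
    have h2 : ‖(imaginaryPart (φ a) : B)‖ ≤ ‖φ a‖ := imaginaryPart.norm_le (φ a)
    calc _ ≤ ‖x‖ + ‖Complex.I • y‖ := norm_add_le _ _
      _ = ‖x‖ + ‖y‖ := by rw [norm_smul]; simp
      _ ≤ _ := by linarith

theorem hh_surj_of_dense {A B : Type*} [NonUnitalCStarAlgebra A] [NonUnitalCStarAlgebra B]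
    (φ : A →⋆ₙₐ[ℂ] B) (h : DenseRange φ) : Function.Surjective φ := by
  let f : NormedAddGroupHom A B :=
    { toFun := φ
      map_add' := map_add φ
      bound' := ⟨1, fun v => by simpa using NonUnitalStarAlgHom.norm_apply_le φ v⟩ }
  have key := controlled_closure_of_complete (f := f) (K := f.range) (C := 2) (ε := 1)
    (by norm_num) (by norm_num) (by
      rintro _ ⟨a, rfl⟩
      exact hh_lift φ a)
  intro b
  have hb : b ∈ f.range.topologicalClosure := by
    have := h b
    exact this
  obtain ⟨a, ha, -⟩ := key b hb
  exact ⟨a, ha⟩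

section
open scoped ComplexOrder

theorem hh_pos {A : Type} [CStarAlgebra A] [PartialOrder A] [StarOrderedRing A]
    (f : StrongDual ℂ A) (hf : ‖f‖ ≤ 1) (h1 : f 1 = 1) (x : A) (hx : 0 ≤ x) : 0 ≤ f x := by
  have hfn : ∀ y, ‖f y‖ ≤ ‖y‖ := fun y =>
    (f.le_opNorm y).trans (by nlinarith [norm_nonneg y])
  have hsa : IsSelfAdjoint x := hx.isSelfAdjoint
  have : Nontrivial A := ⟨0, 1, fun h => by simp [← h] at h1⟩
  have him : ∀ t : ℝ, (f x).re ^ 2 + ((f x).im - t) ^ 2 ≤ ‖x‖ ^ 2 + t ^ 2 := by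
    intro t
    have h := hfn (x - (t * Complex.I) • (1 : A))
    have h2 : ‖x - (t * Complex.I) • (1 : A)‖ ^ 2 ≤ ‖x‖ ^ 2 + t ^ 2 := by
      rw [sq, ← CStarRing.norm_star_mul_self]
      have : star (x - (t * Complex.I) • (1 : A)) * (x - (t * Complex.I) • (1 : A))
          = x * x + ((t : ℂ) ^ 2) • (1 : A) := by
        rw [star_sub, star_smul, hsa.star_eq, star_one]
        simp only [sub_mul, mul_sub, smul_mul_assoc, mul_smul_comm, one_mul, mul_one,
          Complex.star_def, map_mul, Complex.conj_I, Complex.conj_ofReal]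
        have : (t * -Complex.I) * (t * Complex.I) = (t : ℂ) ^ 2 := by
          ring_nf; simp
        rw [← this]
        module
      rw [this]
      refine (norm_add_le _ _).trans ?_
      rw [norm_smul, norm_one, mul_one]
      have := norm_mul_le x x
      simp
      nlinarith
    have h3 : ‖f (x - (t * Complex.I) • (1 : A))‖ ^ 2 = (f x).re ^ 2 + ((f x).im - t) ^ 2 := by
      rw [map_sub, map_smul, h1, Complex.sq_norm, Complex.normSq_apply]
      simp
      ring
    rw [← h3]
    refine le_trans ?_ h2
    gcongr
  have him0 : (f x).im = 0 := by
    by_contra hne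
    have h := him (-(‖x‖ ^ 2 + 1) / (f x).im)
    have h5 : (f x).im * (-(‖x‖ ^ 2 + 1) / (f x).im) = -(‖x‖ ^ 2 + 1) := by
      field_simp
    nlinarith [sq_nonneg (f x).re, sq_nonneg (f x).im, sq_nonneg ‖x‖]
  have hre : 0 ≤ (f x).re := by
    have h := hfn ((‖x‖ : ℂ) • (1 : A) - x)
    have h2 : ‖(‖x‖ : ℂ) • (1 : A) - x‖ ≤ ‖x‖ := by
      have hle : x ≤ algebraMap ℝ A ‖x‖ := hsa.le_algebraMap_norm_self
      have e : (‖x‖ : ℂ) • (1 : A) = algebraMap ℝ A ‖x‖ := by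
        rw [Algebra.algebraMap_eq_smul_one, Complex.coe_smul]
      rw [e]
      refine (CStarAlgebra.norm_le_norm_of_nonneg_of_le (sub_nonneg.2 hle)
        (sub_le_self _ hx)).trans ?_
      rw [norm_algebraMap']
      simp
    have h3 := (Complex.abs_re_le_norm _).trans (h.trans h2)
    rw [map_sub, map_smul, h1] at h3
    simp at h3
    have := (abs_le.1 h3).2
    linarith
  rw [Complex.le_def]
  simp [hre, him0]

theorem hh_state {A : Type} [CStarAlgebra A] [Nontrivial A] (a : A) (ha : IsSelfAdjoint a) :
    ∃ f : StrongDual ℂ A, ‖f‖ ≤ 1 ∧ f 1 = 1 ∧ ‖f a‖ = ‖a‖ := by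
  have := ha.isStarNormal
  let E := StarAlgebra.elemental ℂ a
  let a₀ : E := ⟨a, StarAlgebra.elemental.self_mem ℂ a⟩
  have ha₀ : IsSelfAdjoint a₀ := Subtype.ext ha
  have : Nontrivial E := ⟨0, 1, fun h => zero_ne_one (congrArg Subtype.val h)⟩
  obtain ⟨z, hz, hz'⟩ := spectrum.exists_nnnorm_eq_spectralRadius (A := E) a₀
  rw [ha₀.spectralRadius_eq_nnnorm] at hz'
  have hz'' : ‖z‖ = ‖a‖ := by
    have : ‖z‖₊ = ‖a₀‖₊ := by exact_mod_cast hz'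
    exact congrArg NNReal.toReal this
  obtain ⟨χ, hχ⟩ := WeakDual.CharacterSpace.mem_spectrum_iff_exists.1 hz
  obtain ⟨f, hf, hfn⟩ := exists_extension_norm_eq (𝕜 := ℂ) (E := A)
    (Subalgebra.toSubmodule E.toSubalgebra) (WeakDual.toStrongDual (χ : WeakDual ℂ E))
  refine ⟨f, ?_, ?_, ?_⟩
  · rw [hfn]
    exact (WeakDual.CharacterSpace.norm_le_norm_one χ).trans (by simp)
  · exact (hf (1 : E)).trans (map_one χ)
  · rw [← hz'', ← hχ]
    exact congrArg _ (hf a₀)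

theorem hh_gns {B : Type} [NonUnitalCStarAlgebra B] (b : B) :
    ∃ (H : Type) (_ : NormedAddCommGroup H) (_ : InnerProductSpace ℂ H) (_ : CompleteSpace H)
      (π : B →⋆ₙₐ[ℂ] (H →L[ℂ] H)), ‖b‖ ≤ ‖π b‖ := by
  let A := Unitization ℂ B
  let : PartialOrder A := CStarAlgebra.spectralOrder A
  have : StarOrderedRing A := CStarAlgebra.spectralOrderedRing A
  let c : A := (b : A)
  obtain ⟨f, hf, h1, hfa⟩ := hh_state (star c * c) (.star_mul_self c)
  let F : A →ₚ[ℂ] ℂ :=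
    { toLinearMap := f.toLinearMap
      monotone' := by
        intro x y hxy
        have := hh_pos f hf h1 (y - x) (sub_nonneg.2 hxy)
        rw [map_sub] at this
        exact sub_nonneg.1 this }
  have hF : ∀ x, F x = f x := fun _ => rfl
  refine ⟨F.GNS, inferInstance, inferInstance, inferInstance,
    F.gnsNonUnitalStarAlgHom.comp (Unitization.inrNonUnitalStarAlgHom ℂ B), ?_⟩
  have hc : ‖c‖ = ‖b‖ := Unitization.norm_inr (𝕜 := ℂ) b
  have e1 : ‖(F.toPreGNS 1 : F.PreGNS)‖ = 1 := by
    rw [F.preGNS_norm_def]; simp [hF, h1]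
  have e2 : ‖(F.toPreGNS c : F.PreGNS)‖ = ‖b‖ := by
    have h := F.preGNS_norm_sq (F.toPreGNS c)
    rw [F.ofPreGNS_toPreGNS, hF] at h
    have h' := congrArg norm h
    rw [hfa, CStarRing.norm_star_mul_self, hc] at h'
    simp at h'
    rw [← sq, sq_eq_sq₀ (norm_nonneg _) (norm_nonneg _)] at h'
    exact h'
  have h := (F.gnsNonUnitalStarAlgHom c).le_opNorm ((F.toPreGNS 1 : F.PreGNS) : F.GNS)
  rw [F.gnsNonUnitalStarAlgHom_apply_coe, UniformSpace.Completion.norm_coe,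
    UniformSpace.Completion.norm_coe, e1, mul_one, F.leftMulMapPreGNS_apply,
    F.ofPreGNS_toPreGNS] at h
  simp only [mul_one] at h
  rw [← e2]
  simpa using! h
end


section AAlgLemmas

theorem hh_sum_congr_zero {C : StarCatNu} {A : Type} [NonUnitalRing A] [Module ℂ A]
    [SMulCommClass ℂ A A] [IsScalarTower ℂ A A] [StarRing A] [StarModule ℂ A]
    (w : IsAAlg C A) (X Y : C.Obj) : w.ι (0 : C.Hom X Y) = 0 := by
  have := w.ι_smul X Y 0 0
  simpa using this

/-- `ι` as a linear map. -/
def hhLin {C : StarCatNu} {A : Type} [NonUnitalRing A] [Module ℂ A]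
    [SMulCommClass ℂ A A] [IsScalarTower ℂ A A] [StarRing A] [StarModule ℂ A]
    (w : IsAAlg C A) (X Y : C.Obj) : C.Hom X Y →ₗ[ℂ] A where
  toFun f := w.ι f
  map_add' := w.ι_add X Y
  map_smul' := w.ι_smul X Y

theorem hh_induction {C : StarCatNu} {A : Type} [NonUnitalRing A] [Module ℂ A]
    [SMulCommClass ℂ A A] [IsScalarTower ℂ A A] [StarRing A] [StarModule ℂ A]
    (w : IsAAlg C A) {P : A → Prop} (h0 : P 0) (hadd : ∀ a b, P a → P b → P (a + b))
    (hι : ∀ (X Y : C.Obj) (f : C.Hom X Y), P (w.ι f)) (a : A) : P a := by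
  obtain ⟨s, φ, rfl⟩ := w.span a
  exact Finset.sum_induction _ P hadd h0 (fun p _ => hι _ _ _)

open Classical in
theorem hh_linear {C : StarCatNu} {A : Type} [NonUnitalRing A] [Module ℂ A]
    [SMulCommClass ℂ A A] [IsScalarTower ℂ A A] [StarRing A] [StarModule ℂ A]
    (w : IsAAlg C A) {M : Type} [AddCommGroup M] [Module ℂ M]
    (L : ∀ X Y : C.Obj, C.Hom X Y →ₗ[ℂ] M) :
    ∃ T : A →ₗ[ℂ] M, ∀ (X Y : C.Obj) (f : C.Hom X Y), T (w.ι f) = L X Y f := by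
  let ev : (Π₀ p : C.Obj × C.Obj, C.Hom p.1 p.2) →ₗ[ℂ] A :=
    DFinsupp.lsum ℂ (fun p => hhLin w p.1 p.2)
  have hev : ∀ x : (Π₀ p : C.Obj × C.Obj, C.Hom p.1 p.2), ev x = ∑ p ∈ x.support, w.ι (x p) := by
    intro x
    simp only [ev, DFinsupp.lsum_apply_apply, DFinsupp.sumAddHom_apply]
    rfl
  have hsingle : ∀ (p : C.Obj × C.Obj) (f : C.Hom p.1 p.2),
      ev (DFinsupp.single p f) = w.ι f := by
    intro p f
    exact DFinsupp.lsum_single ℂ (fun p : C.Obj × C.Obj => hhLin w p.1 p.2) p f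
  have hinj : Function.Injective ev := by
    rw [injective_iff_map_eq_zero]
    intro x hx
    rw [hev] at hx
    have := w.indep x.support (fun p => x p) hx
    ext1 p
    by_cases hp : p ∈ x.support
    · exact this p hp
    · simpa using hp
  have hsurj : Function.Surjective ev := by
    intro a
    refine hh_induction w (P := fun a => ∃ x, ev x = a) ⟨0, map_zero _⟩ ?_ ?_ a
    · rintro _ _ ⟨x, rfl⟩ ⟨y, rfl⟩
      exact ⟨x + y, map_add _ _ _⟩
    · intro X Y f
      exact ⟨_, hsingle (X, Y) f⟩
  let e := LinearEquiv.ofBijective ev ⟨hinj, hsurj⟩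
  refine ⟨(DFinsupp.lsum ℂ (fun p : C.Obj × C.Obj => L p.1 p.2)).comp e.symm.toLinearMap, ?_⟩
  intro X Y f
  have : e.symm (w.ι f) = DFinsupp.single (X, Y) f := by
    rw [LinearEquiv.symm_apply_eq]
    exact (hsingle (X, Y) f).symm
  show (DFinsupp.lsum ℂ (fun p : C.Obj × C.Obj => L p.1 p.2)) (e.symm (w.ι f)) = _
  rw [this]
  exact DFinsupp.lsum_single ℂ (fun p : C.Obj × C.Obj => L p.1 p.2) (X, Y) f

open Classical in
theorem hh_coord {C : StarCatNu} {A : Type} [NonUnitalRing A] [Module ℂ A]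
    [SMulCommClass ℂ A A] [IsScalarTower ℂ A A] [StarRing A] [StarModule ℂ A]
    (w : IsAAlg C A) (X Y : C.Obj) :
    ∃ T : A →ₗ[ℂ] C.Hom X Y, (∀ f : C.Hom X Y, T (w.ι f) = f) ∧
      ∀ (X' Y' : C.Obj) (f : C.Hom X' Y'), (X' ≠ X ∨ Y' ≠ Y) → T (w.ι f) = 0 := by
  obtain ⟨T, hT⟩ := hh_linear w (M := C.Hom X Y) (fun X' Y' =>
    if h : X' = X ∧ Y' = Y then (by obtain ⟨rfl, rfl⟩ := h; exact LinearMap.id) else 0)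
  refine ⟨T, fun f => ?_, fun X' Y' f h => ?_⟩
  · rw [hT, dif_pos ⟨rfl, rfl⟩]
    rfl
  · rw [hT, dif_neg (by tauto)]
    rfl

theorem hh_indep {C : StarCatNu} {A : Type} [NonUnitalRing A] [Module ℂ A]
    [SMulCommClass ℂ A A] [IsScalarTower ℂ A A] [StarRing A] [StarModule ℂ A]
    (w : IsAAlg C A) {κ : Type} (s : Finset (κ × κ)) (e : κ → C.Obj) (he : Function.Injective e)
    (ψ : ∀ p : κ × κ, C.Hom (e p.1) (e p.2)) (h : (∑ p ∈ s, w.ι (ψ p)) = 0) :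
    ∀ p ∈ s, ψ p = 0 := by
  intro p hp
  obtain ⟨T, hT, hT'⟩ := hh_coord w (e p.1) (e p.2)
  have := congrArg T h
  rw [map_sum, map_zero, Finset.sum_eq_single_of_mem p hp, hT] at this
  · exact this
  · intro q _ hq
    apply hT'
    by_contra hc
    push Not at hc
    exact hq (Prod.ext (he hc.1) (he hc.2))

theorem hh_hom {C : StarCatNu} {A : Type} [NonUnitalRing A] [Module ℂ A]
    [SMulCommClass ℂ A A] [IsScalarTower ℂ A A] [StarRing A] [StarModule ℂ A]
    (w : IsAAlg C A) {B : Type} [NonUnitalRing B] [Module ℂ B]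
    [SMulCommClass ℂ B B] [IsScalarTower ℂ B B] [StarRing B] [StarModule ℂ B]
    (L : ∀ X Y : C.Obj, C.Hom X Y →ₗ[ℂ] B)
    (hmul : ∀ (X Y Z : C.Obj) (g : C.Hom Y Z) (f : C.Hom X Y),
      L Y Z g * L X Y f = L X Z (C.comp g f))
    (hne : ∀ (X Y X' Y' : C.Obj) (g : C.Hom X' Y') (f : C.Hom X Y), Y ≠ X' →
      L X' Y' g * L X Y f = 0)
    (hstar : ∀ (X Y : C.Obj) (f : C.Hom X Y), star (L X Y f) = L Y X (C.star f)) :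
    ∃ φ : A →⋆ₙₐ[ℂ] B, ∀ (X Y : C.Obj) (f : C.Hom X Y), φ (w.ι f) = L X Y f := by
  obtain ⟨T, hT⟩ := hh_linear w L
  refine ⟨{ toFun := T
            map_smul' := fun c x => T.map_smul c x
            map_zero' := T.map_zero
            map_add' := T.map_add
            map_mul' := ?_
            map_star' := ?_ }, hT⟩
  · intro x y
    show T (x * y) = T x * T y
    refine hh_induction w (P := fun x => T (x * y) = T x * T y) (by simp) ?_ ?_ x
    · intro a b ha hb
      rw [add_mul, map_add, ha, hb, map_add, add_mul]
    · intro X' Y' g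
      refine hh_induction w (P := fun y => T (w.ι g * y) = T (w.ι g) * T y) (by simp) ?_ ?_ y
      · intro a b ha hb
        rw [mul_add, map_add, ha, hb, map_add, mul_add]
      · intro X Y f
        by_cases h : Y = X'
        · subst h
          rw [w.ι_mul_comp, hT, hT, hT, hmul]
        · rw [w.ι_mul_ne _ _ _ _ g f h, hT, hT, hne _ _ _ _ g f h, map_zero]
  · intro x
    show T (star x) = star (T x)
    refine hh_induction w (P := fun x => T (star x) = star (T x)) (by simp) ?_ ?_ x
    · intro a b ha hb
      rw [star_add, map_add, ha, hb, map_add, star_add]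
    · intro X Y f
      rw [w.ι_star, hT, hT, hstar]

/-- The homomorphism induced by a functor which is injective on objects. -/
theorem hh_functor_hom {C D : StarCatNu} {A : Type} [NonUnitalRing A] [Module ℂ A]
    [SMulCommClass ℂ A A] [IsScalarTower ℂ A A] [StarRing A] [StarModule ℂ A]
    (w : IsAAlg C A) {B : Type} [NonUnitalRing B] [Module ℂ B]
    [SMulCommClass ℂ B B] [IsScalarTower ℂ B B] [StarRing B] [StarModule ℂ B]
    (w' : IsAAlg D B) (F : StarFunctor C D) (hF : Function.Injective F.obj) :
    ∃ φ : A →⋆ₙₐ[ℂ] B, ∀ (X Y : C.Obj) (f : C.Hom X Y), φ (w.ι f) = w'.ι (F.map f) := by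
  refine hh_hom w (fun X Y =>
    { toFun := fun f => w'.ι (F.map f)
      map_add' := fun f g => by rw [F.map_add, w'.ι_add]
      map_smul' := fun c f => by rw [F.map_smul, w'.ι_smul]; rfl }) ?_ ?_ ?_
  · intro X Y Z g f
    show w'.ι (F.map g) * w'.ι (F.map f) = w'.ι (F.map (C.comp g f))
    rw [F.map_comp, w'.ι_mul_comp]
  · intro X Y X' Y' g f h
    exact w'.ι_mul_ne _ _ _ _ _ _ (fun h' => h (hF h'))
  · intro X Y f
    show star (w'.ι (F.map f)) = w'.ι (F.map (C.star f))
    rw [F.map_star, w'.ι_star]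

theorem hh_part1 (C D Q : StarCatNu) (i : StarFunctor C D) (p : StarFunctor D Q)
      (hE : IsExactSeq i p)
      (AC : Type) [NonUnitalRing AC] [Module ℂ AC] [SMulCommClass ℂ AC AC]
        [IsScalarTower ℂ AC AC] [StarRing AC] [StarModule ℂ AC]
      (AD : Type) [NonUnitalRing AD] [Module ℂ AD] [SMulCommClass ℂ AD AD]
        [IsScalarTower ℂ AD AD] [StarRing AD] [StarModule ℂ AD]
      (AQ : Type) [NonUnitalRing AQ] [Module ℂ AQ] [SMulCommClass ℂ AQ AQ]
        [IsScalarTower ℂ AQ AQ] [StarRing AQ] [StarModule ℂ AQ]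
      (wC : IsAAlg C AC) (wD : IsAAlg D AD) (wQ : IsAAlg Q AQ)
        (Φi : AC →⋆ₙₐ[ℂ] AD) (Φp : AD →⋆ₙₐ[ℂ] AQ)
        (hi : ∀ (X Y : C.Obj) (f : C.Hom X Y), Φi (wC.ι f) = wD.ι (i.map f))
        (hp : ∀ (X Y : D.Obj) (f : D.Hom X Y), Φp (wD.ι f) = wQ.ι (p.map f)) :
        (Function.Injective Φi ∧ Function.Surjective Φp ∧
          ∀ a : AD, Φp a = 0 ↔ ∃ c : AC, Φi c = a) := by
  refine ⟨?_, ?_, ?_⟩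
  · rw [injective_iff_map_eq_zero]
    intro a ha
    obtain ⟨s, ψ, rfl⟩ := wC.span a
    rw [map_sum] at ha
    simp only [hi] at ha
    have h := hh_indep wD s i.obj hE.i_obj_bij.1 (fun q => i.map (ψ q)) ha
    refine Finset.sum_eq_zero fun q hq => ?_
    have h0 : ψ q = 0 := hE.i_map_inj _ _ ((h q hq).trans (i.map_zero _ _).symm)
    rw [h0, hh_sum_congr_zero]
  · intro b
    refine hh_induction wQ (P := fun b => ∃ a, Φp a = b) ⟨0, map_zero _⟩ ?_ ?_ b
    · rintro _ _ ⟨x, rfl⟩ ⟨y, rfl⟩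
      exact ⟨x + y, map_add _ _ _⟩
    · intro X Y f
      obtain ⟨X, rfl⟩ := hE.p_quot.1.2 X
      obtain ⟨Y, rfl⟩ := hE.p_quot.1.2 Y
      obtain ⟨g, rfl⟩ := hE.p_quot.2 X Y f
      exact ⟨_, hp _ _ g⟩
  · intro a
    constructor
    · intro ha
      obtain ⟨s, ψ, rfl⟩ := wD.span a
      rw [map_sum] at ha
      simp only [hp] at ha
      have h := hh_indep wQ s p.obj hE.p_quot.1.1 (fun q => p.map (ψ q)) ha
      have key : ∀ q ∈ s, wD.ι (ψ q) ∈ AddMonoidHom.mrange (Φi : AC →+ AD) := by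
        rintro ⟨X, Y⟩ hq
        have h1 := h _ hq
        generalize ψ (X, Y) = f at h1
        simp only at f h1
        obtain ⟨X, rfl⟩ := hE.i_obj_bij.2 X
        obtain ⟨Y, rfl⟩ := hE.i_obj_bij.2 Y
        obtain ⟨g, rfl⟩ := (hE.exact X Y f).1 h1
        exact ⟨_, hi _ _ g⟩
      exact sum_mem key
    · rintro ⟨c, rfl⟩
      refine hh_induction wC (P := fun c => Φp (Φi c) = 0) (by simp) ?_ ?_ c
      · intro a b ha hb
        rw [map_add, map_add, ha, hb, add_zero]
      · intro X Y f
        rw [hi, hp, (hE.exact X Y _).2 ⟨f, rfl⟩, hh_sum_congr_zero]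

end AAlgLemmas


section CompletionLemmas

theorem hh_algMaxNorm_le {C : StarCatNu} {A : Type} [NonUnitalRing A] [Module ℂ A]
    [SMulCommClass ℂ A A] [IsScalarTower ℂ A A] [StarRing A] [StarModule ℂ A]
    (w : IsAAlg C A) {X Y : C.Obj} (f : C.Hom X Y) : algMaxNorm A (w.ι f) ≤ C.maxNorm f := by
  refine sSup_le ?_
  rintro _ ⟨B, hB, φ, rfl⟩
  refine le_sSup ⟨B, hB,
    { obj := fun _ => PUnit.unit
      map := fun f => (φ (w.ι f) : B)
      map_add := fun X Y f g => ?_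
      map_smul := fun X Y c f => ?_
      map_comp := fun X Y Z g f => ?_
      map_star := fun X Y f => ?_ }, rfl⟩
  · exact (congrArg φ (w.ι_add X Y f g)).trans (map_add φ _ _)
  · exact (congrArg φ (w.ι_smul X Y c f)).trans (map_smul φ _ _)
  · exact (congrArg φ (w.ι_mul_comp X Y Z g f).symm).trans (map_mul φ _ _)
  · exact (congrArg φ (w.ι_star X Y f).symm).trans (map_star φ _)

/-- A functor to a one-object category as a family of linear maps. -/
def hhRep {C : StarCatNu} {B : Type} [NonUnitalCStarAlgebra B]
    (ρ : StarFunctor C (StarCatNu.ofAlgebra B)) (X Y : C.Obj) : C.Hom X Y →ₗ[ℂ] B where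
  toFun f := (ρ.map f : B)
  map_add' := ρ.map_add X Y
  map_smul' := ρ.map_smul X Y

theorem hhRep_comp {C : StarCatNu} {B : Type} [NonUnitalCStarAlgebra B]
    (ρ : StarFunctor C (StarCatNu.ofAlgebra B)) (X Y Z : C.Obj) (g : C.Hom Y Z) (f : C.Hom X Y) :
    hhRep ρ X Z (C.comp g f) = hhRep ρ Y Z g * hhRep ρ X Y f :=
  ρ.map_comp X Y Z g f

theorem hhRep_star {C : StarCatNu} {B : Type} [NonUnitalCStarAlgebra B]
    (ρ : StarFunctor C (StarCatNu.ofAlgebra B)) (X Y : C.Obj) (f : C.Hom X Y) :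
    hhRep ρ Y X (C.star f) = star (hhRep ρ X Y f) :=
  ρ.map_star X Y f

open Classical in
theorem hh_isometries (κ H : Type) [NormedAddCommGroup H] [InnerProductSpace ℂ H]
    [CompleteSpace H] :
    ∃ (K : Type) (_ : NormedAddCommGroup K) (_ : InnerProductSpace ℂ K) (_ : CompleteSpace K)
      (V : κ → (H →L[ℂ] K)), (∀ x, ‖V x‖ ≤ 1) ∧
      (∀ x, (V x).adjoint.comp (V x) = ContinuousLinearMap.id ℂ H) ∧
      (∀ x y, x ≠ y → (V x).adjoint.comp (V y) = 0) := by
  refine ⟨lp (fun _ : κ => H) 2, inferInstance, inferInstance, inferInstance,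
    fun x => lp.singleContinuousLinearMap ℂ (fun _ : κ => H) 2 x, ?_, ?_, ?_⟩
  · intro x
    refine ContinuousLinearMap.opNorm_le_bound _ zero_le_one fun v => ?_
    rw [lp.singleContinuousLinearMap_apply, lp.norm_single (by norm_num), one_mul]
  · intro x
    ext v
    refine ext_inner_left ℂ fun u => ?_
    rw [ContinuousLinearMap.comp_apply, ContinuousLinearMap.adjoint_inner_right,
      lp.singleContinuousLinearMap_apply, lp.singleContinuousLinearMap_apply,
      lp.inner_single_left, lp.single_apply_self]
    rfl
  · intro x y hxy
    ext v
    refine ext_inner_left ℂ fun u => ?_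
    rw [ContinuousLinearMap.comp_apply, ContinuousLinearMap.adjoint_inner_right,
      lp.singleContinuousLinearMap_apply, lp.singleContinuousLinearMap_apply,
      lp.inner_single_left, lp.single_apply_ne _ _ _ hxy]
    simp

theorem hh_maxNorm_le {C : StarCatNu} {A : Type} [NonUnitalRing A] [Module ℂ A]
    [SMulCommClass ℂ A A] [IsScalarTower ℂ A A] [StarRing A] [StarModule ℂ A]
    (w : IsAAlg C A) (s : Finset (C.Obj × C.Obj)) (ψ : ∀ p : C.Obj × C.Obj, C.Hom p.1 p.2)
    (p : C.Obj × C.Obj) (hp : p ∈ s) :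
    C.maxNorm (ψ p) ≤ algMaxNorm A (∑ q ∈ s, w.ι (ψ q)) := by
  refine sSup_le ?_
  rintro _ ⟨B, hB, ρ, rfl⟩
  obtain ⟨H, _, _, _, π, hπ⟩ := hh_gns (hhRep ρ p.1 p.2 (ψ p))
  obtain ⟨K, _, _, _, V, hV, hV1, hV0⟩ := hh_isometries C.Obj H
  have hstarV : ∀ X Y (T : H →L[ℂ] H), star (V Y ∘L T ∘L (V X).adjoint)
      = V X ∘L star T ∘L (V Y).adjoint := by
    intro X Y T
    rw [ContinuousLinearMap.star_eq_adjoint, ContinuousLinearMap.star_eq_adjoint,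
      ContinuousLinearMap.adjoint_comp, ContinuousLinearMap.adjoint_comp,
      ContinuousLinearMap.adjoint_adjoint, ContinuousLinearMap.comp_assoc]
  obtain ⟨φ, hφ⟩ := hh_hom w (B := K →L[ℂ] K) (fun X Y =>
    { toFun := fun f => V Y ∘L (π (hhRep ρ X Y f)) ∘L (V X).adjoint
      map_add' := fun f g => by
        rw [map_add, map_add, ContinuousLinearMap.add_comp, ContinuousLinearMap.comp_add]
      map_smul' := fun c f => by
        rw [map_smul, map_smul, ContinuousLinearMap.smul_comp, ContinuousLinearMap.comp_smul]
        rfl })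
    (by
      intro X Y Z g f
      show (V Z ∘L (π (hhRep ρ Y Z g)) ∘L (V Y).adjoint) ∘L
        (V Y ∘L (π (hhRep ρ X Y f)) ∘L (V X).adjoint) =
        V Z ∘L (π (hhRep ρ X Z (C.comp g f))) ∘L (V X).adjoint
      rw [hhRep_comp, map_mul]
      ext v
      have := fun u => DFunLike.congr_fun (hV1 Y) u
      simp only [ContinuousLinearMap.comp_apply, ContinuousLinearMap.id_apply] at this
      simp [this])
    (by
      intro X Y X' Y' g f hne
      show (V Y' ∘L (π (hhRep ρ X' Y' g)) ∘L (V X').adjoint) ∘L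
        (V Y ∘L (π (hhRep ρ X Y f)) ∘L (V X).adjoint) = 0
      ext v
      have := fun u => DFunLike.congr_fun (hV0 X' Y (Ne.symm hne)) u
      simp only [ContinuousLinearMap.comp_apply, ContinuousLinearMap.zero_apply] at this
      simp [this])
    (by
      intro X Y f
      show star (V Y ∘L (π (hhRep ρ X Y f)) ∘L (V X).adjoint) =
        V X ∘L (π (hhRep ρ Y X (C.star f))) ∘L (V Y).adjoint
      rw [hstarV, hhRep_star, map_star])
  have hle : algRepNorm A (∑ q ∈ s, w.ι (ψ q)) (K →L[ℂ] K) φ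
      ≤ algMaxNorm A (∑ q ∈ s, w.ι (ψ q)) := le_sSup ⟨_, _, φ, rfl⟩
  refine le_trans ?_ hle
  have hcomp : (V p.2).adjoint ∘L (φ (∑ q ∈ s, w.ι (ψ q))) ∘L V p.1
      = π (hhRep ρ p.1 p.2 (ψ p)) := by
    ext v
    have h1 : ∀ X u, (V X).adjoint (V X u) = u := fun X u => DFunLike.congr_fun (hV1 X) u
    have h0 : ∀ X Y u, X ≠ Y → (V X).adjoint (V Y u) = 0 :=
      fun X Y u h => DFunLike.congr_fun (hV0 X Y h) u
    rw [map_sum, ContinuousLinearMap.comp_apply, ContinuousLinearMap.comp_apply,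
      ContinuousLinearMap.sum_apply, map_sum, Finset.sum_eq_single_of_mem p hp]
    · rw [hφ]
      simp [h1]
    · intro q _ hq
      rw [hφ]
      by_cases h2 : q.2 = p.2
      · have h3 : q.1 ≠ p.1 := fun h3 => hq (Prod.ext h3 h2)
        simp [h0 _ _ _ h3]
      · simp [h0 _ _ _ (Ne.symm h2)]
  have hn : ‖hhRep ρ p.1 p.2 (ψ p)‖ ≤ ‖φ (∑ q ∈ s, w.ι (ψ q))‖ := by
    refine hπ.trans ?_
    rw [← hcomp]
    have hVa : ‖(V p.2).adjoint‖ ≤ 1 := by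
      rw [LinearIsometryEquiv.norm_map]; exact hV _
    calc _ ≤ ‖(V p.2).adjoint‖ * (‖φ (∑ q ∈ s, w.ι (ψ q))‖ * ‖V p.1‖) :=
          (ContinuousLinearMap.opNorm_comp_le _ _).trans
            (mul_le_mul_of_nonneg_left (ContinuousLinearMap.opNorm_comp_le _ _) (norm_nonneg _))
      _ ≤ 1 * (‖φ (∑ q ∈ s, w.ι (ψ q))‖ * 1) := by
          gcongr
          exact hV _
      _ = _ := by ring
  exact ENNReal.coe_le_coe.2 hn

variable {C : StarCatNu} {A : Type} [NonUnitalRing A] [Module ℂ A]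
    [SMulCommClass ℂ A A] [IsScalarTower ℂ A A] [StarRing A] [StarModule ℂ A]

theorem hh_j_inj (hC : IsCStar C) (w : IsAAlg C A) {A' : Type} [NonUnitalCStarAlgebra A']
    (j : A →⋆ₙₐ[ℂ] A') (hj : IsAlgCompletion A A' j) : Function.Injective j := by
  rw [injective_iff_map_eq_zero]
  intro a ha
  obtain ⟨s, ψ, rfl⟩ := w.span a
  refine Finset.sum_eq_zero fun q hq => ?_
  have h := hh_maxNorm_le w s ψ q hq
  rw [← hj.isometric, ha] at h
  have h0 : C.maxNorm (ψ q) = 0 := by simpa using h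
  rw [hC.2.1 _ _ _ h0, hh_sum_congr_zero]

open Classical in
theorem hh_corner_mem (w : IsAAlg C A) (a : A) : ∃ (F : Finset C.Obj)
    (ψ : ∀ p : C.Obj × C.Obj, C.Hom p.1 p.2), a = ∑ p ∈ F ×ˢ F, w.ι (ψ p) := by
  obtain ⟨s, ψ, rfl⟩ := w.span a
  refine ⟨s.image Prod.fst ∪ s.image Prod.snd, fun p => if p ∈ s then ψ p else 0, ?_⟩
  have hsub : s ⊆ (s.image Prod.fst ∪ s.image Prod.snd) ×ˢ (s.image Prod.fst ∪ s.image Prod.snd) := by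
    intro q hq
    rw [Finset.mem_product]
    exact ⟨Finset.mem_union_left _ (Finset.mem_image_of_mem _ hq),
      Finset.mem_union_right _ (Finset.mem_image_of_mem _ hq)⟩
  rw [← Finset.sum_subset hsub]
  · exact Finset.sum_congr rfl fun q hq => by simp only [if_pos hq]
  · intro q _ hq
    simp only [if_neg hq]
    exact hh_sum_congr_zero w _ _

/-- The linear map whose range is the corner. -/
def hhCorner (w : IsAAlg C A) {A' : Type} [NonUnitalCStarAlgebra A']
    (j : A →⋆ₙₐ[ℂ] A') (F : Finset C.Obj) :
    (∀ p : C.Obj × C.Obj, C.Hom p.1 p.2) →ₗ[ℂ] A' where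
  toFun ψ := j (∑ p ∈ F ×ˢ F, w.ι (ψ p))
  map_add' ψ χ := by
    simp only [Pi.add_apply, w.ι_add, Finset.sum_add_distrib, map_add]
  map_smul' c ψ := by
    simp only [Pi.smul_apply, w.ι_smul, ← Finset.smul_sum, map_smul, RingHom.id_apply]

open Classical in
theorem hh_single_mem (w : IsAAlg C A) {A' : Type} [NonUnitalCStarAlgebra A']
    (j : A →⋆ₙₐ[ℂ] A') (F : Finset C.Obj) (X Y : C.Obj) (hX : X ∈ F) (hY : Y ∈ F)
    (f : C.Hom X Y) : j (w.ι f) ∈ LinearMap.range (hhCorner w j F) := by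
  refine ⟨Pi.single (M := fun p : C.Obj × C.Obj => C.Hom p.1 p.2) (X, Y) f, ?_⟩
  show j (∑ p ∈ F ×ˢ F, w.ι _) = _
  rw [Finset.sum_eq_single_of_mem (X, Y) (Finset.mem_product.2 ⟨hX, hY⟩), Pi.single_eq_same]
  intro q _ hq
  rw [Pi.single_eq_of_ne hq, hh_sum_congr_zero]

/-- The corner as a subalgebra. -/
def hhCornerAlg (w : IsAAlg C A) {A' : Type} [NonUnitalCStarAlgebra A']
    (j : A →⋆ₙₐ[ℂ] A') (F : Finset C.Obj) : NonUnitalStarSubalgebra ℂ A' where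
  carrier := LinearMap.range (hhCorner w j F)
  add_mem' := fun ha hb => (LinearMap.range (hhCorner w j F)).add_mem ha hb
  zero_mem' := (LinearMap.range (hhCorner w j F)).zero_mem
  smul_mem' := fun c _ ha => (LinearMap.range (hhCorner w j F)).smul_mem c ha
  mul_mem' := by
    rintro _ _ ⟨ψ, rfl⟩ ⟨χ, rfl⟩
    show j (∑ p ∈ F ×ˢ F, w.ι (ψ p)) * j (∑ p ∈ F ×ˢ F, w.ι (χ p)) ∈
      LinearMap.range (hhCorner w j F)
    rw [← map_mul, Finset.sum_mul_sum, map_sum]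
    refine Submodule.sum_mem _ fun p hp => ?_
    rw [map_sum]
    refine Submodule.sum_mem _ fun q hq => ?_
    rw [Finset.mem_product] at hp hq
    obtain ⟨Y', Z⟩ := p
    obtain ⟨X, Y⟩ := q
    by_cases h : Y = Y'
    · subst h
      rw [w.ι_mul_comp]
      exact hh_single_mem w j F _ _ hq.1 hp.2 _
    · rw [w.ι_mul_ne _ _ _ _ _ _ h, map_zero]
      exact Submodule.zero_mem _
  star_mem' := by
    rintro _ ⟨ψ, rfl⟩
    show star (j (∑ p ∈ F ×ˢ F, w.ι (ψ p))) ∈ LinearMap.range (hhCorner w j F)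
    rw [← map_star, star_sum, map_sum]
    refine Submodule.sum_mem _ fun p hp => ?_
    rw [Finset.mem_product] at hp
    rw [w.ι_star]
    exact hh_single_mem w j F _ _ hp.2 hp.1 _

open Classical Filter Topology in
theorem hh_corner_closed (hC : IsCStar C) (w : IsAAlg C A) {A' : Type} [NonUnitalCStarAlgebra A']
    (j : A →⋆ₙₐ[ℂ] A') (hj : IsAlgCompletion A A' j) (F : Finset C.Obj) :
    IsClosed (hhCornerAlg w j F : Set A') := by
  rw [← isSeqClosed_iff_isClosed]
  intro y a hy hya
  choose ψ hψ using hy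
  have hest : ∀ p ∈ F ×ˢ F, ∀ m n, C.maxNorm (ψ m p - ψ n p) ≤ edist (y m) (y n) := by
    intro p hp m n
    have h := hh_maxNorm_le w (F ×ˢ F) (ψ m - ψ n) p hp
    rw [← hj.isometric] at h
    have e : j (∑ q ∈ F ×ˢ F, w.ι ((ψ m - ψ n) q)) = y m - y n := by
      rw [← hψ m, ← hψ n, ← map_sub]; rfl
    rw [e] at h
    rw [edist_eq_enorm_sub]
    exact h
  have hlim : ∀ p : C.Obj × C.Obj, ∃ f : C.Hom p.1 p.2, p ∈ F ×ˢ F →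
      ∀ ε : ℝ≥0∞, 0 < ε → ∃ N, ∀ n ≥ N, C.maxNorm (ψ n p - f) < ε := by
    intro p
    by_cases hp : p ∈ F ×ˢ F
    · obtain ⟨f, hf⟩ := hC.2.2 p.1 p.2 (fun n => ψ n p) (by
        intro ε hε
        obtain ⟨N, hN⟩ := EMetric.cauchySeq_iff.1 hya.cauchySeq ε hε
        exact ⟨N, fun m hm n hn => (hest p hp m n).trans_lt (hN m hm n hn)⟩)
      exact ⟨f, fun _ => hf⟩
    · exact ⟨0, fun h => absurd h hp⟩
  choose χ hχ using hlim
  refine ⟨χ, ?_⟩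
  refine tendsto_nhds_unique ?_ hya
  have e1 : y = fun n => ∑ p ∈ F ×ˢ F, j (w.ι (ψ n p)) := by
    funext n
    rw [← hψ n, ← map_sum]; rfl
  have e2 : hhCorner w j F χ = ∑ p ∈ F ×ˢ F, j (w.ι (χ p)) := by
    rw [← map_sum]; rfl
  rw [e1, e2]
  refine tendsto_finsetSum _ fun p hp => ?_
  rw [EMetric.tendsto_atTop]
  intro ε hε
  obtain ⟨N, hN⟩ := hχ p hp ε hε
  refine ⟨N, fun n hn => lt_of_le_of_lt ?_ (hN n hn)⟩
  rw [edist_eq_enorm_sub, ← map_sub]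
  have e3 : w.ι (ψ n p) - w.ι (χ p) = w.ι (ψ n p - χ p) := (map_sub (hhLin w p.1 p.2) _ _).symm
  rw [e3]
  exact (hj.isometric _).le.trans (hh_algMaxNorm_le w _)

end CompletionLemmas

theorem hh_part2 (C D Q : StarCatNu) (hC : IsCStar C) (hD : IsCStar D) (hQ : IsCStar Q)
      (i : StarFunctor C D) (p : StarFunctor D Q) (hE : IsExactSeq i p)
      (AC : Type) [NonUnitalRing AC] [Module ℂ AC] [SMulCommClass ℂ AC AC]
        [IsScalarTower ℂ AC AC] [StarRing AC] [StarModule ℂ AC]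
      (AD : Type) [NonUnitalRing AD] [Module ℂ AD] [SMulCommClass ℂ AD AD]
        [IsScalarTower ℂ AD AD] [StarRing AD] [StarModule ℂ AD]
      (AQ : Type) [NonUnitalRing AQ] [Module ℂ AQ] [SMulCommClass ℂ AQ AQ]
        [IsScalarTower ℂ AQ AQ] [StarRing AQ] [StarModule ℂ AQ]
      (wC : IsAAlg C AC) (wD : IsAAlg D AD) (wQ : IsAAlg Q AQ)
      (AC' : Type) [NonUnitalCStarAlgebra AC'] (jC : AC →⋆ₙₐ[ℂ] AC')
        (hjC : IsAlgCompletion AC AC' jC)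
      (AD' : Type) [NonUnitalCStarAlgebra AD'] (jD : AD →⋆ₙₐ[ℂ] AD')
        (hjD : IsAlgCompletion AD AD' jD)
      (AQ' : Type) [NonUnitalCStarAlgebra AQ'] (jQ : AQ →⋆ₙₐ[ℂ] AQ')
        (hjQ : IsAlgCompletion AQ AQ' jQ)
      (Ψi : AC' →⋆ₙₐ[ℂ] AD') (Ψp : AD' →⋆ₙₐ[ℂ] AQ')
        (hi : ∀ (X Y : C.Obj) (f : C.Hom X Y), Ψi (jC (wC.ι f)) = jD (wD.ι (i.map f)))
        (hp : ∀ (X Y : D.Obj) (f : D.Hom X Y), Ψp (jD (wD.ι f)) = jQ (wQ.ι (p.map f))) :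
        (Function.Injective Ψi ∧ Function.Surjective Ψp ∧
          ∀ a : AD', Ψp a = 0 ↔ ∃ c : AC', Ψi c = a) := by
  obtain ⟨Φi, hΦi⟩ := hh_functor_hom wC wD i hE.i_obj_bij.1
  obtain ⟨Φp, hΦp⟩ := hh_functor_hom wD wQ p hE.p_quot.1.1
  obtain ⟨h1, h2, h3⟩ := hh_part1 C D Q i p hE AC AD AQ wC wD wQ Φi Φp hΦi hΦp
  have hi' : ∀ a, Ψi (jC a) = jD (Φi a) := by
    refine hh_induction wC (by simp) (fun a b ha hb => ?_) (fun X Y f => by rw [hi, hΦi])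
    rw [map_add, map_add, ha, hb, map_add, map_add]
  have hp' : ∀ a, Ψp (jD a) = jQ (Φp a) := by
    refine hh_induction wD (by simp) (fun a b ha hb => ?_) (fun X Y f => by rw [hp, hΦp])
    rw [map_add, map_add, ha, hb, map_add, map_add]
  have iD := hh_j_inj hD wD jD hjD
  have iQ := hh_j_inj hQ wQ jQ hjQ
  have hnorm0 : ∀ a, ‖Ψi (jC a)‖ = ‖jC a‖ := by
    intro a
    obtain ⟨F, ψ, ha⟩ := hh_corner_mem wC a
    have hcl : IsClosed (hhCornerAlg wC jC F : Set AC') := hh_corner_closed hC wC jC hjC F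
    let Θ : hhCornerAlg wC jC F →⋆ₙₐ[ℂ] AD' :=
      Ψi.comp (NonUnitalStarSubalgebraClass.subtype (hhCornerAlg wC jC F))
    have hΘ : Function.Injective Θ := by
      rw [injective_iff_map_eq_zero]
      rintro ⟨_, χ, rfl⟩ hz
      have hz' : Ψi (jC (∑ p ∈ F ×ˢ F, wC.ι (χ p))) = 0 := hz
      rw [hi'] at hz'
      have h4 := (injective_iff_map_eq_zero Φi).1 h1 _ ((injective_iff_map_eq_zero jD).1 iD _ hz')
      refine Subtype.ext ?_
      show jC (∑ p ∈ F ×ˢ F, wC.ι (χ p)) = 0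
      rw [h4, map_zero]
    have := NonUnitalStarAlgHom.norm_map Θ hΘ ⟨jC a, ψ, by rw [ha]; rfl⟩
    exact this
  have hnorm : ∀ y, ‖Ψi y‖ = ‖y‖ := by
    intro y
    refine hjC.dense.induction_on (p := fun y => ‖Ψi y‖ = ‖y‖) y ?_ hnorm0
    exact isClosed_eq (hh_cont Ψi).norm continuous_norm
  have hiso : Isometry Ψi := AddMonoidHomClass.isometry_of_norm Ψi hnorm
  refine ⟨hiso.injective, ?_, ?_⟩
  · refine hh_surj_of_dense Ψp ?_
    refine hjQ.dense.mono ?_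
    rintro _ ⟨b, rfl⟩
    obtain ⟨a, rfl⟩ := h2 b
    exact ⟨_, hp' a⟩
  · intro a
    constructor
    · intro ha
      have hcl : IsClosed (Set.range Ψi) := hiso.isClosedEmbedding.isClosed_range
      show a ∈ Set.range Ψi
      rw [← hcl.closure_eq, Metric.mem_closure_iff]
      intro ε hε
      obtain ⟨_, ⟨x, rfl⟩, hx⟩ := Metric.mem_closure_iff.1 (hjD.dense a) (ε / 3) (by positivity)
      rw [dist_eq_norm] at hx
      have hpx : ‖Ψp (jD x)‖ < ε / 3 := by
        have : Ψp (jD x) = - Ψp (a - jD x) := by rw [map_sub, ha]; simp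
        rw [this, norm_neg]
        exact (NonUnitalStarAlgHom.norm_apply_le Ψp _).trans_lt hx
      obtain ⟨F, ψ, hxF⟩ := hh_corner_mem wD x
      have hclF : IsClosed (hhCornerAlg wD jD F : Set AD') := hh_corner_closed hD wD jD hjD F
      let Θ : hhCornerAlg wD jD F →⋆ₙₐ[ℂ] AQ' :=
        Ψp.comp (NonUnitalStarSubalgebraClass.subtype (hhCornerAlg wD jD F))
      obtain ⟨⟨_, χ, rfl⟩, hz1, hz2⟩ := hh_lift Θ ⟨jD x, ψ, by rw [hxF]; rfl⟩
      have hz1' : Ψp (jD (∑ p ∈ F ×ˢ F, wD.ι (χ p))) = Ψp (jD x) := hz1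
      have hz2' : ‖jD (∑ p ∈ F ×ˢ F, wD.ι (χ p))‖ ≤ 2 * ‖Ψp (jD x)‖ := hz2
      generalize (∑ p ∈ F ×ˢ F, wD.ι (χ p)) = x' at hz1' hz2'
      rw [hp', hp'] at hz1'
      have hk : Φp (x - x') = 0 := by rw [map_sub, iQ hz1', sub_self]
      obtain ⟨c, hc⟩ := (h3 _).1 hk
      refine ⟨_, ⟨jC c, rfl⟩, ?_⟩
      rw [hi', hc, map_sub, dist_eq_norm]
      have : a - (jD x - jD x') = (a - jD x) + jD x' := by abel
      rw [this]
      refine (norm_add_le _ _).trans_lt ?_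
      linarith
    · rintro ⟨c, rfl⟩
      refine hjC.dense.induction_on (p := fun c => Ψp (Ψi c) = 0) c ?_ ?_
      · exact isClosed_eq ((hh_cont Ψp).comp (hh_cont Ψi)) continuous_const
      · intro x
        rw [hi', hp', (h3 _).2 ⟨x, rfl⟩, map_zero]


/-- (1) If `0 → C → D → Q → 0` is an exact sequence in `∗Cat^nu_ℂ`, then
`0 → A^alg(C) → A^alg(D) → A^alg(Q) → 0` is an exact sequence of ∗-algebras over ℂ.
(2) If `0 → C → D → Q → 0` is an exact sequence of C*-categories, then
`0 → A(C) → A(D) → A(Q) → 0` is an exact sequence of C*-algebras.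
(The induced homomorphisms are characterized by `[f] ↦ [i(f)]` resp. `[f] ↦ [p(f)]` on
generators; exactness of a sequence of algebras means: the first map is injective, the
second is surjective, and the range of the first is the kernel of the second.) -/
theorem AAlg_and_A_preserve_exact_sequences :
    (∀ (C D Q : StarCatNu) (i : StarFunctor C D) (p : StarFunctor D Q),
      IsExactSeq i p →
      ∀ (AC : Type) [NonUnitalRing AC] [Module ℂ AC] [SMulCommClass ℂ AC AC]
        [IsScalarTower ℂ AC AC] [StarRing AC] [StarModule ℂ AC],
      ∀ (AD : Type) [NonUnitalRing AD] [Module ℂ AD] [SMulCommClass ℂ AD AD]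
        [IsScalarTower ℂ AD AD] [StarRing AD] [StarModule ℂ AD],
      ∀ (AQ : Type) [NonUnitalRing AQ] [Module ℂ AQ] [SMulCommClass ℂ AQ AQ]
        [IsScalarTower ℂ AQ AQ] [StarRing AQ] [StarModule ℂ AQ],
      ∀ (wC : IsAAlg C AC) (wD : IsAAlg D AD) (wQ : IsAAlg Q AQ)
        (Φi : AC →⋆ₙₐ[ℂ] AD) (Φp : AD →⋆ₙₐ[ℂ] AQ),
        (∀ (X Y : C.Obj) (f : C.Hom X Y), Φi (wC.ι f) = wD.ι (i.map f)) →
        (∀ (X Y : D.Obj) (f : D.Hom X Y), Φp (wD.ι f) = wQ.ι (p.map f)) →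
        (Function.Injective Φi ∧ Function.Surjective Φp ∧
          ∀ a : AD, Φp a = 0 ↔ ∃ c : AC, Φi c = a)) ∧
    (∀ (C D Q : StarCatNu), IsCStar C → IsCStar D → IsCStar Q →
      ∀ (i : StarFunctor C D) (p : StarFunctor D Q), IsExactSeq i p →
      ∀ (AC : Type) [NonUnitalRing AC] [Module ℂ AC] [SMulCommClass ℂ AC AC]
        [IsScalarTower ℂ AC AC] [StarRing AC] [StarModule ℂ AC],
      ∀ (AD : Type) [NonUnitalRing AD] [Module ℂ AD] [SMulCommClass ℂ AD AD]
        [IsScalarTower ℂ AD AD] [StarRing AD] [StarModule ℂ AD],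
      ∀ (AQ : Type) [NonUnitalRing AQ] [Module ℂ AQ] [SMulCommClass ℂ AQ AQ]
        [IsScalarTower ℂ AQ AQ] [StarRing AQ] [StarModule ℂ AQ],
      ∀ (wC : IsAAlg C AC) (wD : IsAAlg D AD) (wQ : IsAAlg Q AQ),
      ∀ (AC' : Type) [NonUnitalCStarAlgebra AC'] (jC : AC →⋆ₙₐ[ℂ] AC')
        (_ : IsAlgCompletion AC AC' jC),
      ∀ (AD' : Type) [NonUnitalCStarAlgebra AD'] (jD : AD →⋆ₙₐ[ℂ] AD')
        (_ : IsAlgCompletion AD AD' jD),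
      ∀ (AQ' : Type) [NonUnitalCStarAlgebra AQ'] (jQ : AQ →⋆ₙₐ[ℂ] AQ')
        (_ : IsAlgCompletion AQ AQ' jQ),
      ∀ (Ψi : AC' →⋆ₙₐ[ℂ] AD') (Ψp : AD' →⋆ₙₐ[ℂ] AQ'),
        (∀ (X Y : C.Obj) (f : C.Hom X Y), Ψi (jC (wC.ι f)) = jD (wD.ι (i.map f))) →
        (∀ (X Y : D.Obj) (f : D.Hom X Y), Ψp (jD (wD.ι f)) = jQ (wQ.ι (p.map f))) →
        (Function.Injective Ψi ∧ Function.Surjective Ψp ∧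
          ∀ a : AD', Ψp a = 0 ↔ ∃ c : AC', Ψi c = a)) := by
  refine ⟨?_, ?_⟩
  · intro C D Q i p hE AC _ _ _ _ _ _ AD _ _ _ _ _ _ AQ _ _ _ _ _ _ wC wD wQ Φi Φp hi hp
    exact hh_part1 C D Q i p hE AC AD AQ wC wD wQ Φi Φp hi hp
  · intro C D Q hC hD hQ i p hE AC _ _ _ _ _ _ AD _ _ _ _ _ _ AQ _ _ _ _ _ _ wC wD wQ
      AC' _ jC hjC AD' _ jD hjD AQ' _ jQ hjQ Ψi Ψp hi hp
    exact hh_part2 C D Q hC hD hQ i p hE AC AD AQ wC wD wQ AC' jC hjC AD' jD hjD AQ' jQ hjQ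
      Ψi Ψp hi hp
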